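/- Let a, b ∈ ℝ and let k : ℝ³ → ℝ be the function k(x) = 1 + (3x₁² − 2x₂² − x₃²)/(1+|x|²)² + (|x|⁴/(1+|x|²)³)(b − a/(1+|x|²) − (1−a)/(1+|x|²)²). Then the principal value integral a₀ := lim_{r→0} ∫_{ℝ³ ∖ B_r(0)} (k(x) − T²_{k,0}(x)) |x|^{−6} dx exists and equals −(π²/64)(35 − 48b + 5a), where T²_{k,0}(x) = k(0) + Dk(0)(x) + (1/2) D²k(0)(x,x) is the second-order Taylor polynomial of k at 0. -/

import Mathlib

open MeasureTheory Real

/-- The function `k` from the example in the paper. -/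
noncomputable def kfun (a b : ℝ) (x : EuclideanSpace ℝ (Fin 3)) : ℝ :=
  1 + (3 * x 0 ^ 2 - 2 * x 1 ^ 2 - x 2 ^ 2) / (1 + ‖x‖ ^ 2) ^ 2 +
    ‖x‖ ^ 4 / (1 + ‖x‖ ^ 2) ^ 3 *
      (b - a / (1 + ‖x‖ ^ 2) - (1 - a) / (1 + ‖x‖ ^ 2) ^ 2)

/-- The second-order Taylor polynomial of `k` at `0`. -/
noncomputable def taylor2 (k : EuclideanSpace ℝ (Fin 3) → ℝ) (x : EuclideanSpace ℝ (Fin 3)) : ℝ :=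
  k 0 + fderiv ℝ k 0 x + (1 / 2) * iteratedFDeriv ℝ 2 k 0 (fun _ => x)

lemma hasDerivAt_fderiv_smul_apply {E : Type*} [NormedAddCommGroup E] [NormedSpace ℝ E]
    {f : E → ℝ} (hf : DifferentiableAt ℝ (fderiv ℝ f) 0) (x : E) :
    HasDerivAt (fun t : ℝ => fderiv ℝ f (t • x) x) (fderiv ℝ (fderiv ℝ f) 0 x x) 0 := by
  have hline : HasDerivAt (fun t : ℝ => t • x) x 0 := by
    simpa using (hasDerivAt_id (0 : ℝ)).smul_const x
  have h := hf.hasFDerivAt.comp_hasDerivAt_of_eq (0 : ℝ) hline (zero_smul ℝ x).symm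
  simpa using h.clm_apply (hasDerivAt_const (0 : ℝ) x)

lemma taylor2_kfun (a b : ℝ) (x : EuclideanSpace ℝ (Fin 3)) :
    taylor2 (kfun a b) x = 1 + (3 * x 0 ^ 2 - 2 * x 1 ^ 2 - x 2 ^ 2) := by
  have hpos : ∀ y : EuclideanSpace ℝ (Fin 3), 1 + ‖y‖ ^ 2 ≠ 0 := fun y => by positivity
  have hk : ContDiff ℝ 2 (kfun a b) := by
    unfold kfun
    have hn : ContDiff ℝ 2 fun y : EuclideanSpace ℝ (Fin 3) => ‖y‖ ^ 2 := contDiff_norm_sq ℝ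
    have hn4 : ContDiff ℝ 2 fun y : EuclideanSpace ℝ (Fin 3) => ‖y‖ ^ 4 := by
      have := hn.pow 2
      simpa only [← pow_mul] using this
    have hu : ContDiff ℝ 2 fun y : EuclideanSpace ℝ (Fin 3) => 1 + ‖y‖ ^ 2 :=
      contDiff_const.add hn
    have hc : ∀ i, ContDiff ℝ 2 fun y : EuclideanSpace ℝ (Fin 3) => y i := fun i => by fun_prop
    refine ContDiff.add (contDiff_const.add (ContDiff.div ?_ (hu.pow 2) fun y => pow_ne_zero _ (hpos y)))
      ((hn4.div (hu.pow 3) fun y => pow_ne_zero _ (hpos y)).mul ((contDiff_const.sub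
        (contDiff_const.div hu hpos)).sub (contDiff_const.div (hu.pow 2) fun y => pow_ne_zero _ (hpos y))))
    exact ((contDiff_const.mul ((hc 0).pow 2)).sub (contDiff_const.mul ((hc 1).pow 2))).sub
      ((hc 2).pow 2)
  have hd : Differentiable ℝ (kfun a b) := hk.differentiable (by norm_num)
  have hd' : Differentiable ℝ (fderiv ℝ (kfun a b)) :=
    (hk.fderiv_right (m := 1) (by norm_num)).differentiable (by norm_num)
  set q : ℝ := 3 * x 0 ^ 2 - 2 * x 1 ^ 2 - x 2 ^ 2 with hq
  set s : ℝ := ‖x‖ ^ 2 with hs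
  let h : ℝ → ℝ := fun t => q / (1 + t ^ 2 * s) ^ 2 + t ^ 2 * s ^ 2 / (1 + t ^ 2 * s) ^ 3 *
    (b - a / (1 + t ^ 2 * s) - (1 - a) / (1 + t ^ 2 * s) ^ 2)
  have hpos' : ∀ t : ℝ, 1 + t ^ 2 * s ≠ 0 := fun t => by positivity
  have hh : ContDiff ℝ 1 h := by
    have hu : ContDiff ℝ 1 fun t : ℝ => 1 + t ^ 2 * s := by fun_prop
    have hu' : ContDiff ℝ 1 fun t : ℝ => t ^ 2 * s ^ 2 := by fun_prop
    exact (contDiff_const.div (hu.pow 2) fun y => pow_ne_zero _ (hpos' y)).add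
      ((hu'.div (hu.pow 3) fun y => pow_ne_zero _ (hpos' y)).mul ((contDiff_const.sub
        (contDiff_const.div hu hpos')).sub
          (contDiff_const.div (hu.pow 2) fun y => pow_ne_zero _ (hpos' y))))
  have hline : ∀ t : ℝ, kfun a b (t • x) = 1 + t ^ 2 * h t := by
    intro t
    have h1 : ‖t • x‖ ^ 2 = t ^ 2 * s := by rw [norm_smul, mul_pow, Real.norm_eq_abs, sq_abs]
    have h2 : ‖t • x‖ ^ 4 = t ^ 4 * s ^ 2 := by
      calc ‖t • x‖ ^ 4 = (‖t • x‖ ^ 2) ^ 2 := by ring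
        _ = t ^ 4 * s ^ 2 := by rw [h1]; ring
    simp only [kfun, h1, h2, h, PiLp.smul_apply, smul_eq_mul, hq]
    ring
  have hlined : ∀ t : ℝ, HasDerivAt (fun t : ℝ => t • x) x t := fun t => by
    simpa using (hasDerivAt_id t).smul_const x
  have hfirst : ∀ t : ℝ, fderiv ℝ (kfun a b) (t • x) x = t * (2 * h t + t * deriv h t) := by
    intro t
    have e1 := (hd (t • x)).hasFDerivAt.comp_hasDerivAt t (hlined t)
    have e2 : HasDerivAt (fun t => 1 + t ^ 2 * h t) (2 * t * h t + t ^ 2 * deriv h t) t := by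
      have := (((hasDerivAt_id t).pow 2).mul
        ((hh.differentiable (by norm_num)) t).hasDerivAt).const_add 1
      simpa using this
    have e3 : (kfun a b ∘ fun t : ℝ => t • x) = fun t => 1 + t ^ 2 * h t := funext hline
    rw [e3] at e1
    rw [e1.unique e2]
    ring
  have hsecond : fderiv ℝ (fderiv ℝ (kfun a b)) 0 x x = 2 * q := by
    have e1 := hasDerivAt_fderiv_smul_apply (hd' 0) x
    simp only [hfirst] at e1
    have hc : Continuous fun t => 2 * h t + t * deriv h t := by
      have := hh.continuous_deriv (by norm_num)
      have := hh.continuous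
      fun_prop
    have e2 : HasDerivAt (fun t => t * (2 * h t + t * deriv h t)) (2 * q) 0 := by
      rw [hasDerivAt_iff_tendsto_slope]
      have h0 : Filter.Tendsto (fun t => 2 * h t + t * deriv h t) (nhdsWithin 0 {0}ᶜ)
          (nhds (2 * q)) := by
        have := (hc.tendsto 0).mono_left (nhdsWithin_le_nhds (s := {0}ᶜ))
        simpa [h] using this
      refine h0.congr' ?_
      filter_upwards [self_mem_nhdsWithin] with t ht
      have ht : t ≠ 0 := ht
      simp [slope_def_field, ht]
    exact e1.unique e2
  have hzero : fderiv ℝ (kfun a b) 0 x = 0 := by simpa using hfirst 0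
  have hk0 : kfun a b 0 = 1 := by simpa using hline 0
  rw [taylor2, iteratedFDeriv_two_apply, hzero, hk0, hsecond]
  ring

lemma integrable_mul_coord_sq {φ : ℝ → ℝ} (hφ : Measurable φ)
    (hint : Integrable fun x : EuclideanSpace ℝ (Fin 3) => φ ‖x‖ * ‖x‖ ^ 2) (i : Fin 3) :
    Integrable fun x : EuclideanSpace ℝ (Fin 3) => φ ‖x‖ * x i ^ 2 := by
  refine hint.mono ?_ (Filter.Eventually.of_forall fun x => ?_)
  · have : Measurable fun x : EuclideanSpace ℝ (Fin 3) => φ ‖x‖ * x i ^ 2 :=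
      (hφ.comp measurable_norm).mul (by fun_prop)
    exact this.aestronglyMeasurable
  · rw [norm_mul, norm_mul, norm_pow, norm_pow, norm_norm]
    gcongr
    exact PiLp.norm_apply_le x i

lemma integral_mul_coord_sq_eq (φ : ℝ → ℝ) (i j : Fin 3) :
    ∫ x : EuclideanSpace ℝ (Fin 3), φ ‖x‖ * x i ^ 2 =
      ∫ x : EuclideanSpace ℝ (Fin 3), φ ‖x‖ * x j ^ 2 := by
  let e := LinearIsometryEquiv.piLpCongrLeft 2 ℝ ℝ (Equiv.swap i j)
  have h := e.measurePreserving.integral_comp e.toHomeomorph.measurableEmbedding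
    (fun x : EuclideanSpace ℝ (Fin 3) => φ ‖x‖ * x i ^ 2)
  rw [← h]
  congr 1
  ext x
  have h1 : (e x) i = x j := by
    simp [e, LinearIsometryEquiv.piLpCongrLeft_apply, Equiv.piCongrLeft']
  rw [e.norm_map, h1]

/-- An antiderivative of `b / (1 + y²)³ - a / (1 + y²)⁴ - (1 - a) / (1 + y²)⁵`. -/
noncomputable def radialPrimitive (a b y : ℝ) : ℝ :=
  (3 * b / 8 - 5 * a / 16 - 35 * (1 - a) / 128) * (arctan y + y / (1 + y ^ 2)) +
    (b / 4 - 5 * a / 24 - 35 * (1 - a) / 192) * (y / (1 + y ^ 2) ^ 2) -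
    (a / 6 + 7 * (1 - a) / 48) * (y / (1 + y ^ 2) ^ 3) - (1 - a) / 8 * (y / (1 + y ^ 2) ^ 4)

lemma hasDerivAt_radialPrimitive (a b y : ℝ) :
    HasDerivAt (radialPrimitive a b)
      (b / (1 + y ^ 2) ^ 3 - a / (1 + y ^ 2) ^ 4 - (1 - a) / (1 + y ^ 2) ^ 5) y := by
  have hu : 1 + y ^ 2 ≠ 0 := by positivity
  have hd : HasDerivAt (fun y : ℝ => 1 + y ^ 2) (2 * y) y := by
    simpa using ((hasDerivAt_id y).pow 2).const_add 1
  have hq : ∀ n : ℕ, HasDerivAt (fun y : ℝ => y / (1 + y ^ 2) ^ n) _ y := fun n =>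
    (hasDerivAt_id y).div (hd.pow n) (pow_ne_zero n hu)
  have hq1 : HasDerivAt (fun y : ℝ => y / (1 + y ^ 2)) _ y := (hasDerivAt_id y).div hd hu
  have h := (((((hasDerivAt_arctan y).add hq1).const_mul
    (3 * b / 8 - 5 * a / 16 - 35 * (1 - a) / 128)).add
    ((hq 2).const_mul (b / 4 - 5 * a / 24 - 35 * (1 - a) / 192))).sub
    ((hq 3).const_mul (a / 6 + 7 * (1 - a) / 48))).sub ((hq 4).const_mul ((1 - a) / 8))
  refine h.congr_deriv ?_
  simp only [id]
  push_cast
  field_simp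
  ring

lemma tendsto_radialPrimitive_atTop (a b : ℝ) :
    Filter.Tendsto (radialPrimitive a b) Filter.atTop
      (nhds ((3 * b / 8 - 5 * a / 16 - 35 * (1 - a) / 128) * (π / 2))) := by
  have hq : ∀ n : ℕ, 1 ≤ n →
      Filter.Tendsto (fun y : ℝ => y / (1 + y ^ 2) ^ n) Filter.atTop (nhds 0) := by
    intro n hn
    refine tendsto_of_tendsto_of_tendsto_of_le_of_le' tendsto_const_nhds
      tendsto_inv_atTop_zero ?_ ?_
    · filter_upwards [Filter.eventually_ge_atTop 0] with y hy
      positivity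
    · filter_upwards [Filter.eventually_gt_atTop 0] with y hy
      have h1 : 1 + y ^ 2 ≤ (1 + y ^ 2) ^ n :=
        le_self_pow₀ (by nlinarith [sq_nonneg y]) (by omega)
      rw [div_le_iff₀ (by positivity), inv_mul_eq_div, le_div_iff₀ hy]
      nlinarith
  have hat : Filter.Tendsto arctan Filter.atTop (nhds (π / 2)) :=
    tendsto_nhds_of_tendsto_nhdsWithin tendsto_arctan_atTop
  have hq1 : Filter.Tendsto (fun y : ℝ => y / (1 + y ^ 2)) Filter.atTop (nhds 0) := by
    simpa using hq 1 le_rfl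
  have := ((((hat.add hq1).const_mul (3 * b / 8 - 5 * a / 16 - 35 * (1 - a) / 128)).add
    ((hq 2 (by norm_num)).const_mul (b / 4 - 5 * a / 24 - 35 * (1 - a) / 192))).sub
    ((hq 3 (by norm_num)).const_mul (a / 6 + 7 * (1 - a) / 48))).sub
    ((hq 4 (by norm_num)).const_mul ((1 - a) / 8))
  simp only [add_zero, mul_zero, sub_zero] at this
  exact this

lemma integrable_radial (a b : ℝ) :
    Integrable fun y : ℝ =>
      b / (1 + y ^ 2) ^ 3 - a / (1 + y ^ 2) ^ 4 - (1 - a) / (1 + y ^ 2) ^ 5 := by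
  have hp : ∀ (c : ℝ) (n : ℕ), 1 ≤ n → Integrable fun y : ℝ => c / (1 + y ^ 2) ^ n := by
    intro c n hn
    have : Integrable fun y : ℝ => ((1 + y ^ 2) ^ n)⁻¹ := by
      refine integrable_inv_one_add_sq.mono' (Continuous.aestronglyMeasurable ?_)
        (Filter.Eventually.of_forall fun y => ?_)
      · exact Continuous.inv₀ (by fun_prop) fun y => by positivity
      · rw [norm_of_nonneg (by positivity)]
        gcongr
        exact le_self_pow₀ (by nlinarith [sq_nonneg y]) (by omega)
    simpa [div_eq_mul_inv] using this.const_mul c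
  exact ((hp b 3 (by norm_num)).sub (hp a 4 (by norm_num))).sub (hp (1 - a) 5 (by norm_num))

lemma integral_radial (a b ρ : ℝ) :
    ∫ y in Set.Ioi ρ, (b / (1 + y ^ 2) ^ 3 - a / (1 + y ^ 2) ^ 4 - (1 - a) / (1 + y ^ 2) ^ 5) =
      (3 * b / 8 - 5 * a / 16 - 35 * (1 - a) / 128) * (π / 2) - radialPrimitive a b ρ :=
  integral_Ioi_of_hasDerivAt_of_tendsto' (fun y _ => hasDerivAt_radialPrimitive a b y)
    (integrable_radial a b).integrableOn (tendsto_radialPrimitive_atTop a b)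

lemma integral_compl_ball_kfun (a b : ℝ) {ρ : ℝ} (hρ : 0 < ρ) :
    ∫ x in (Metric.ball (0 : EuclideanSpace ℝ (Fin 3)) ρ)ᶜ,
      (kfun a b x - taylor2 (kfun a b) x) * ‖x‖ ^ (-6 : ℝ) =
    4 * π * ((3 * b / 8 - 5 * a / 16 - 35 * (1 - a) / 128) * (π / 2) - radialPrimitive a b ρ) := by
  set w : ℝ → ℝ := fun y =>
    b / (1 + y ^ 2) ^ 3 - a / (1 + y ^ 2) ^ 4 - (1 - a) / (1 + y ^ 2) ^ 5 with hw
  let φ : ℝ → ℝ := (Set.Ici ρ).indicator fun r => (((1 + r ^ 2) ^ 2)⁻¹ - 1) * (r ^ 6)⁻¹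
  let ψ : ℝ → ℝ := (Set.Ici ρ).indicator fun r => (r ^ 2)⁻¹ * w r
  have hφ : Measurable φ := Measurable.indicator (by fun_prop) measurableSet_Ici
  have hdim : Module.finrank ℝ (EuclideanSpace ℝ (Fin 3)) - 1 = 2 := by simp
  have hφint : Integrable fun x : EuclideanSpace ℝ (Fin 3) => φ ‖x‖ * ‖x‖ ^ 2 := by
    rw [integrable_fun_norm_addHaar volume (f := fun r => φ r * r ^ 2), hdim]
    refine Integrable.mono' (integrable_inv_one_add_sq.const_mul (1 + (ρ ^ 2)⁻¹)).integrableOn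
      (by
        have : Measurable fun y : ℝ => y ^ 2 • (φ y * y ^ 2) := by fun_prop
        exact this.aestronglyMeasurable)
      (Filter.Eventually.of_forall fun y => ?_)
    by_cases hy : ρ ≤ y
    · have hy0 : 0 < y := hρ.trans_le hy
      have e : y ^ 2 • (φ y * y ^ 2) = -((1 - ((1 + y ^ 2) ^ 2)⁻¹) * (y ^ 2)⁻¹) := by
        simp only [φ, Set.indicator_of_mem (Set.mem_Ici.2 hy), smul_eq_mul]
        field_simp
        ring
      have h1 : ((1 + y ^ 2) ^ 2)⁻¹ ≤ 1 := inv_le_one_of_one_le₀ (by nlinarith [sq_nonneg y])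
      have h2 : 0 ≤ ((1 + y ^ 2) ^ 2)⁻¹ := by positivity
      rw [e, norm_neg, norm_of_nonneg (mul_nonneg (by linarith) (by positivity))]
      calc (1 - ((1 + y ^ 2) ^ 2)⁻¹) * (y ^ 2)⁻¹ ≤ 1 * (y ^ 2)⁻¹ := by gcongr; linarith
        _ = (1 + (y ^ 2)⁻¹) * (1 + y ^ 2)⁻¹ := by field_simp; ring
        _ ≤ (1 + (ρ ^ 2)⁻¹) * (1 + y ^ 2)⁻¹ := by gcongr
    · have : φ y = 0 := Set.indicator_of_notMem (by simpa using hy) _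
      rw [this]
      simp only [zero_mul, smul_zero, norm_zero]
      positivity
  have hψsmul : ∀ y : ℝ, y ^ 2 • ψ y = (Set.Ici ρ).indicator w y := by
    intro y
    by_cases hy : ρ ≤ y
    · have hy0 : y ≠ 0 := (hρ.trans_le hy).ne'
      simp only [ψ, Set.indicator_of_mem (Set.mem_Ici.2 hy), smul_eq_mul]
      field_simp
    · have hy' : y ∉ Set.Ici ρ := by simpa using hy
      simp [ψ, Set.indicator_of_notMem hy']
  have hψint : Integrable fun x : EuclideanSpace ℝ (Fin 3) => ψ ‖x‖ := by
    rw [integrable_fun_norm_addHaar volume (f := ψ), hdim]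
    simp only [hψsmul]
    exact ((integrable_radial a b).indicator measurableSet_Ici).integrableOn
  have hψval : ∫ x : EuclideanSpace ℝ (Fin 3), ψ ‖x‖ = 4 * π * ∫ y in Set.Ioi ρ, w y := by
    rw [integral_fun_norm_addHaar volume ψ, hdim]
    simp only [hψsmul]
    rw [setIntegral_indicator measurableSet_Ici,
      Set.inter_eq_right.2 (Set.Ici_subset_Ioi.2 hρ), integral_Ici_eq_integral_Ioi,
      measureReal_def, EuclideanSpace.volume_ball_fin_three]
    simp only [ENNReal.ofReal_one, one_pow, one_mul, finrank_euclideanSpace, Fintype.card_fin,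
      nsmul_eq_mul, smul_eq_mul, ENNReal.toReal_ofReal (show 0 ≤ π * 4 / 3 by positivity)]
    push_cast
    ring
  have hpt : ∀ x : EuclideanSpace ℝ (Fin 3), (Metric.ball (0 : EuclideanSpace ℝ (Fin 3)) ρ)ᶜ.indicator
      (fun x => (kfun a b x - taylor2 (kfun a b) x) * ‖x‖ ^ (-6 : ℝ)) x =
      (3 * (φ ‖x‖ * x 0 ^ 2) - 2 * (φ ‖x‖ * x 1 ^ 2) - φ ‖x‖ * x 2 ^ 2) + ψ ‖x‖ := by
    intro x
    by_cases hx : ρ ≤ ‖x‖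
    · have hx0 : 0 < ‖x‖ := hρ.trans_le hx
      have hr : ‖x‖ ^ (-6 : ℝ) = (‖x‖ ^ 6)⁻¹ := by
        rw [rpow_neg hx0.le]; norm_cast
      rw [Set.indicator_of_mem (by simpa using hx), hr, taylor2_kfun, kfun]
      simp only [φ, ψ, hw, Set.indicator_of_mem (Set.mem_Ici.2 hx)]
      field_simp
      ring
    · have hx' : ‖x‖ ∉ Set.Ici ρ := by simpa using hx
      rw [Set.indicator_of_notMem (by simpa using hx)]
      simp [φ, ψ, Set.indicator_of_notMem hx']
  have hI : ∀ (c : ℝ) (i : Fin 3),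
      Integrable fun x : EuclideanSpace ℝ (Fin 3) => c * (φ ‖x‖ * x i ^ 2) :=
    fun c i => (integrable_mul_coord_sq hφ hφint i).const_mul c
  have hI2 := integrable_mul_coord_sq hφ hφint 2
  have hI01 : Integrable fun x : EuclideanSpace ℝ (Fin 3) =>
      3 * (φ ‖x‖ * x 0 ^ 2) - 2 * (φ ‖x‖ * x 1 ^ 2) := (hI 3 0).sub (hI 2 1)
  have hI012 : Integrable fun x : EuclideanSpace ℝ (Fin 3) =>
      3 * (φ ‖x‖ * x 0 ^ 2) - 2 * (φ ‖x‖ * x 1 ^ 2) - φ ‖x‖ * x 2 ^ 2 := hI01.sub hI2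
  rw [← integral_indicator measurableSet_ball.compl, integral_congr_ae (.of_forall hpt),
    integral_add hI012 hψint, integral_sub hI01 hI2, integral_sub (hI 3 0) (hI 2 1),
    integral_const_mul, integral_const_mul, integral_mul_coord_sq_eq φ 1 0,
    integral_mul_coord_sq_eq φ 2 0, hψval, integral_radial]
  ring

theorem stmt17 (a b : ℝ) :
    Filter.Tendsto
      (fun ρ : ℝ => ∫ x in (Metric.ball (0 : EuclideanSpace ℝ (Fin 3)) ρ)ᶜ,
        (kfun a b x - taylor2 (kfun a b) x) * ‖x‖ ^ (-6 : ℝ))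
      (nhdsWithin 0 (Set.Ioi 0))
      (nhds (-(Real.pi ^ 2 / 64) * (35 - 48 * b + 5 * a))) := by
  have h := (((hasDerivAt_radialPrimitive a b 0).continuousAt.tendsto.mono_left
    (nhdsWithin_le_nhds (s := Set.Ioi 0))).const_sub
      ((3 * b / 8 - 5 * a / 16 - 35 * (1 - a) / 128) * (π / 2))).const_mul (4 * π)
  have hval : 4 * π * ((3 * b / 8 - 5 * a / 16 - 35 * (1 - a) / 128) * (π / 2) -
      radialPrimitive a b 0) = -(π ^ 2 / 64) * (35 - 48 * b + 5 * a) := by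
    simp only [radialPrimitive, arctan_zero, zero_div]
    ring
  rw [hval] at h
  refine h.congr' ?_
  filter_upwards [self_mem_nhdsWithin] with ρ hρ
  exact (integral_compl_ball_kfun a b hρ).symm
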